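/- If G is a connected graph of order n ≥ 2, then Det(G ∘ K_1) = Det(G). -/

import Mathlib

open SimpleGraph

/-- A labeling `f : V → Fin d` is `d`-distinguishing if the only automorphism
preserving all labels is the identity. -/
def IsDistinguishing {V : Type*} (G : SimpleGraph V) (d : ℕ) (f : V → Fin d) : Prop :=
  ∀ φ : G ≃g G, (∀ v, f (φ v) = f v) → ∀ v, φ v = v

/-- The distinguishing number `D(G)`. -/
noncomputable def distNum {V : Type*} (G : SimpleGraph V) : ℕ :=
  sInf {d | ∃ f : V → Fin d, IsDistinguishing G d f}

/-- The cost `ρ_d(G)`: the minimum size of a label class in a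
`d`-distinguishing labeling of `G`. -/
noncomputable def cost {V : Type*} (G : SimpleGraph V) [Fintype V] (d : ℕ) : ℕ :=
  sInf {k | ∃ (f : V → Fin d) (i : Fin d), IsDistinguishing G d f ∧
    k = (Finset.univ.filter (fun v => f v = i)).card}

/-- `S` is a determining set for `G` if automorphisms agreeing on `S` agree everywhere. -/
def IsDeterminingSet {V : Type*} (G : SimpleGraph V) (S : Set V) : Prop :=
  ∀ φ ψ : G ≃g G, (∀ v ∈ S, φ v = ψ v) → ∀ v, φ v = ψ v

/-- The determining number `Det(G)`. -/
noncomputable def detNum {V : Type*} (G : SimpleGraph V) [Fintype V] : ℕ :=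
  sInf {k | ∃ S : Finset V, IsDeterminingSet G ↑S ∧ S.card = k}

/-- The corona product `G ∘ H`: one copy of `G` and, for each vertex `v` of `G`,
a copy of `H` all of whose vertices are joined to `v`. -/
def corona {V W : Type*} (G : SimpleGraph V) (H : SimpleGraph W) :
    SimpleGraph (V ⊕ V × W) :=
  SimpleGraph.fromRel (fun a b =>
    match a, b with
    | .inl u, .inl v => G.Adj u v
    | .inl u, .inr (v, _) => u = v
    | .inr (u, w), .inr (v, w') => u = v ∧ H.Adj w w'
    | _, _ => False)

namespace corona

variable {V W : Type*} {G : SimpleGraph V} {H : SimpleGraph W}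

@[simp]
theorem adj_inl_inl {u v : V} : (corona G H).Adj (.inl u) (.inl v) ↔ G.Adj u v := by
  simp only [corona, SimpleGraph.fromRel_adj, G.adj_comm v u, or_self, ne_eq, Sum.inl.injEq]
  exact ⟨fun h => h.2, fun h => ⟨h.ne, h⟩⟩

@[simp]
theorem adj_inl_inr {u : V} {p : V × W} : (corona G H).Adj (.inl u) (.inr p) ↔ u = p.1 := by
  simp [corona]

@[simp]
theorem adj_inr_inl {u : V} {p : V × W} : (corona G H).Adj (.inr p) (.inl u) ↔ u = p.1 := by
  rw [SimpleGraph.adj_comm, adj_inl_inr]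

@[simp]
theorem adj_inr_inr {p q : V × W} :
    (corona G H).Adj (.inr p) (.inr q) ↔ p.1 = q.1 ∧ H.Adj p.2 q.2 := by
  obtain ⟨u, w⟩ := p
  obtain ⟨v, w'⟩ := q
  simp only [corona, SimpleGraph.fromRel_adj, ne_eq, Sum.inr.injEq, Prod.mk.injEq]
  constructor
  · rintro ⟨-, h | ⟨h, h'⟩⟩
    exacts [h, ⟨h.symm, h'.symm⟩]
  · exact fun h => ⟨fun h' => h.2.ne h'.2, Or.inl h⟩

/-- The automorphism of `corona G H` which permutes the copies of `H` along an automorphism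
of `G`. -/
def extendAut (H : SimpleGraph W) (σ : G ≃g G) : corona G H ≃g corona G H where
  toEquiv := Equiv.sumCongr σ.toEquiv (Equiv.prodCongr σ.toEquiv (Equiv.refl W))
  map_rel_iff' := by
    rintro (u | ⟨u, w⟩) (v | ⟨v, w'⟩) <;> simp [σ.map_adj_iff]

@[simp]
theorem extendAut_inl (σ : G ≃g G) (v : V) : extendAut H σ (.inl v) = .inl (σ v) := rfl

@[simp]
theorem extendAut_inr (σ : G ≃g G) (p : V × W) :
    extendAut H σ (.inr p) = .inr (σ p.1, p.2) := rfl

theorem existsUnique_adj_inr (p : V × Unit) :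
    ∃! y, (corona G (⊥ : SimpleGraph Unit)).Adj (.inr p) y := by
  refine ⟨.inl p.1, by simp, ?_⟩
  rintro (u | q) h <;> simp_all

theorem not_existsUnique_adj_inl [Nontrivial V] (hG : G.Connected) (v : V) :
    ¬ ∃! y, (corona G (⊥ : SimpleGraph Unit)).Adj (.inl v) y := by
  intro h
  obtain ⟨u, hu⟩ := hG.preconnected.exists_adj_of_nontrivial v
  exact Sum.inl_ne_inr (h.unique (adj_inl_inl.2 hu) (adj_inl_inr (p := (v, ())).2 rfl))

theorem existsUnique_adj_apply {U : Type*} {K : SimpleGraph U} (φ : K ≃g K) (x : U) :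
    (∃! y, K.Adj (φ x) y) ↔ ∃! y, K.Adj x y := by
  rw [φ.toEquiv.bijective.existsUnique_iff]
  exact existsUnique_congr fun y => φ.map_adj_iff

theorem exists_apply_inl [Nontrivial V] (hG : G.Connected)
    (φ : corona G (⊥ : SimpleGraph Unit) ≃g corona G (⊥ : SimpleGraph Unit)) (v : V) :
    ∃ u, φ (.inl v) = .inl u := by
  cases h : φ (.inl v) with
  | inl u => exact ⟨u, rfl⟩
  | inr p =>
    refine absurd ((existsUnique_adj_apply φ _).1 ?_) (not_existsUnique_adj_inl hG v)
    exact h ▸ existsUnique_adj_inr p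

theorem exists_apply_inr [Nontrivial V] (hG : G.Connected)
    (φ : corona G (⊥ : SimpleGraph Unit) ≃g corona G (⊥ : SimpleGraph Unit)) (p : V × Unit) :
    ∃ q, φ (.inr p) = .inr q := by
  cases h : φ (.inr p) with
  | inl u =>
    refine absurd ?_ (not_existsUnique_adj_inl hG u)
    exact h ▸ (existsUnique_adj_apply φ _).2 (existsUnique_adj_inr p)
  | inr q => exact ⟨q, rfl⟩

/-- Every automorphism of `G ∘ K₁` is induced by an automorphism of `G`. -/
theorem extendAut_surjective [Nontrivial V] (hG : G.Connected) :
    Function.Surjective (extendAut (G := G) (⊥ : SimpleGraph Unit)) := by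
  intro φ
  choose f hf using exists_apply_inl hG φ
  choose g hg using exists_apply_inl hG φ.symm
  let σ : G ≃g G :=
    { toFun := f
      invFun := g
      left_inv := fun v => Sum.inl_injective (by rw [← hg, ← hf, φ.symm_apply_apply])
      right_inv := fun v => Sum.inl_injective (by rw [← hf, ← hg, φ.apply_symm_apply])
      map_rel_iff' := fun {u v} => by
        have h := φ.map_adj_iff (v := .inl u) (w := .inl v)
        rwa [hf, hf, adj_inl_inl, adj_inl_inl] at h }
  refine ⟨σ, RelIso.ext ?_⟩
  rintro (v | p)
  · exact (hf v).symm
  · obtain ⟨q, hq⟩ := exists_apply_inr hG φ p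
    have h := φ.map_adj_iff.2 (adj_inl_inr (G := G) (H := ⊥) (p := p).2 rfl)
    rw [hf, hq, adj_inl_inr] at h
    rw [hq, extendAut_inr]
    exact congrArg Sum.inr (Prod.ext h rfl)

theorem isDeterminingSet_image_inl [Nontrivial V] (hG : G.Connected) {S : Set V}
    (hS : IsDeterminingSet G S) :
    IsDeterminingSet (corona G (⊥ : SimpleGraph Unit)) (Sum.inl '' S) := by
  intro φ ψ h
  obtain ⟨σ, rfl⟩ := extendAut_surjective hG φ
  obtain ⟨τ, rfl⟩ := extendAut_surjective hG ψ
  have hστ := hS σ τ fun v hv => Sum.inl_injective (h _ ⟨v, hv, rfl⟩)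
  rintro (v | p) <;> simp [hστ]

theorem isDeterminingSet_image_base {T : Set (V ⊕ V × W)}
    (hT : IsDeterminingSet (corona G H) T) :
    IsDeterminingSet G (Sum.elim id Prod.fst '' T) := by
  intro σ τ h v
  refine Sum.inl_injective (hT (extendAut H σ) (extendAut H τ) ?_ (.inl v))
  rintro (u | p) hx
  · simpa using h u ⟨_, hx, rfl⟩
  · simpa using h p.1 ⟨_, hx, rfl⟩

end corona

theorem detNum_le_card {V : Type*} [Fintype V] {G : SimpleGraph V} {S : Finset V}
    (hS : IsDeterminingSet G ↑S) : detNum G ≤ S.card :=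
  Nat.sInf_le ⟨S, hS, rfl⟩

theorem exists_isDeterminingSet_card_eq_detNum {V : Type*} [Fintype V] (G : SimpleGraph V) :
    ∃ S : Finset V, IsDeterminingSet G ↑S ∧ S.card = detNum G :=
  Nat.sInf_mem (s := {k | ∃ S : Finset V, IsDeterminingSet G ↑S ∧ S.card = k})
    ⟨_, Finset.univ, fun _ _ h v => h v (by simp), rfl⟩

theorem stmt_15 {V : Type*} [Fintype V] (G : SimpleGraph V) (n : ℕ)
    (hn : Fintype.card V = n) (hn2 : 2 ≤ n) (hG : G.Connected) :
    detNum (corona G (⊥ : SimpleGraph Unit)) = detNum G := by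
  classical
  have : Nontrivial V := Fintype.one_lt_card_iff_nontrivial.1 (by omega)
  apply le_antisymm
  · obtain ⟨S, hS, hcard⟩ := exists_isDeterminingSet_card_eq_detNum G
    rw [← hcard]
    refine (detNum_le_card (S := S.image Sum.inl) ?_).trans Finset.card_image_le
    rw [Finset.coe_image]
    exact corona.isDeterminingSet_image_inl hG hS
  · obtain ⟨T, hT, hcard⟩ :=
      exists_isDeterminingSet_card_eq_detNum (corona G (⊥ : SimpleGraph Unit))
    rw [← hcard]
    refine (detNum_le_card (S := T.image (Sum.elim id Prod.fst)) ?_).trans Finset.card_image_le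
    rw [Finset.coe_image]
    exact corona.isDeterminingSet_image_base hT
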